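/- Let G, c, ρ₀ > 0 and r₀ > 0 be constants. There exist no twice differentiable functions u, v : (r₀, ∞) → ℝ satisfying simultaneously, for all r > r₀: (i) −e^{u−v}·[u''/2 + u'/r + (u'/4)(u'−v')] = −(4πG/c⁴)·e^{u}·ρ₀ (the equation R₀₀ = (4πG/c⁴)g₀₀ρ₀); (ii) u''/2 − v'/r + (u'/4)(u'−v') = 0 (the equation R₁₁ = 0); (iii) e^{−v}·[1 − e^{v} + (r/2)(u'−v')] = 0 (the equation R₂₂ = 0); and (iv) u'(r)·ρ₀ = 0 (the conservation condition arising from D^iT_ij = 0). -/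

import Mathlib

open Real

/-- The classical Einstein field equations have no solution in the static spherically
symmetric case with a constant cosmic microwave background energy density `ρ₀ > 0`:
no twice differentiable `u, v` on `(r₀,∞)` satisfy `R₀₀ = (4πG/c⁴)g₀₀ρ₀`, `R₁₁ = 0`,
`R₂₂ = 0` together with the conservation condition `u'·ρ₀ = 0`. -/
theorem no_solution_with_CMB
    (G c ρ₀ r₀ : ℝ) (hG : 0 < G) (hc : 0 < c) (hρ₀ : 0 < ρ₀) (hr₀ : 0 < r₀) :
    ¬ ∃ u u' u'' v v' v'' : ℝ → ℝ,
      (∀ r ∈ Set.Ioi r₀, HasDerivAt u (u' r) r) ∧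
      (∀ r ∈ Set.Ioi r₀, HasDerivAt u' (u'' r) r) ∧
      (∀ r ∈ Set.Ioi r₀, HasDerivAt v (v' r) r) ∧
      (∀ r ∈ Set.Ioi r₀, HasDerivAt v' (v'' r) r) ∧
      (∀ r ∈ Set.Ioi r₀,
        -Real.exp (u r - v r) * (u'' r / 2 + u' r / r + (u' r / 4) * (u' r - v' r))
          = -(4 * π * G / c ^ 4) * Real.exp (u r) * ρ₀) ∧
      (∀ r ∈ Set.Ioi r₀, u'' r / 2 - v' r / r + (u' r / 4) * (u' r - v' r) = 0) ∧
      (∀ r ∈ Set.Ioi r₀,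
        Real.exp (-v r) * (1 - Real.exp (v r) + (r / 2) * (u' r - v' r)) = 0) ∧
      (∀ r ∈ Set.Ioi r₀, u' r * ρ₀ = 0) := by
  rintro ⟨u, u', u'', v, v', v'', -, h2, -, -, h5, -, -, h8⟩
  have hz : ∀ r ∈ Set.Ioi r₀, u' r = 0 := fun r hr =>
    (mul_eq_zero.mp (h8 r hr)).resolve_right hρ₀.ne'
  have hr : r₀ + 1 ∈ Set.Ioi r₀ := by simp
  have hev : u' =ᶠ[nhds (r₀ + 1)] fun _ => (0 : ℝ) :=
    Filter.eventually_of_mem (isOpen_Ioi.mem_nhds hr) hz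
  have hd : u'' (r₀ + 1) = 0 :=
    (h2 _ hr).unique ((hasDerivAt_const (r₀ + 1) (0 : ℝ)).congr_of_eventuallyEq hev)
  have h := h5 _ hr
  rw [hd, hz _ hr] at h
  have hpos : 0 < (4 * π * G / c ^ 4) * Real.exp (u (r₀ + 1)) * ρ₀ := by positivity
  simp only [zero_div, zero_mul, add_zero, mul_zero] at h
  linarith
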